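/- Let α ∈ Δ and σ ∈ 𝓘. Then L(s_α ∘ σ) = L(σ) + 1 if s_α ∘ σ > σ, and L(s_α ∘ σ) = L(σ) − 1 if s_α ∘ σ < σ. -/

import Mathlib

open scoped RealInnerProductSpace
open Classical

noncomputable section

variable (V : Type) [NormedAddCommGroup V] [InnerProductSpace ℝ V]

/-- The reflection determined by a vector `α` (the identity map if `α = 0`),
as a linear endomorphism:  `x ↦ x - (2⟪x,α⟫/⟪α,α⟫) • α`. -/
def reflMap (α : V) : V →ₗ[ℝ] V where
  toFun x := x - (2 * ⟪x, α⟫ / ⟪α, α⟫) • α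
  map_add' x y := by
    simp only [inner_add_left]
    rw [show 2 * (⟪x, α⟫ + ⟪y, α⟫) / ⟪α, α⟫
        = 2 * ⟪x, α⟫ / ⟪α, α⟫ + 2 * ⟪y, α⟫ / ⟪α, α⟫ by ring, add_smul]
    abel
  map_smul' c x := by
    simp only [real_inner_smul_left, RingHom.id_apply, smul_sub]
    rw [show 2 * (c * ⟪x, α⟫) / ⟪α, α⟫ = c * (2 * ⟪x, α⟫ / ⟪α, α⟫) by ring,
      mul_smul]

lemma reflMap_apply (α x : V) :
    reflMap V α x = x - (2 * ⟪x, α⟫ / ⟪α, α⟫) • α := rfl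

lemma reflMap_involutive (α : V) : ∀ x, reflMap V α (reflMap V α x) = x := by
  intro x
  by_cases h : (⟪α, α⟫ : ℝ) = 0
  · have h0 : α = 0 := inner_self_eq_zero.mp h
    simp [reflMap_apply, h0]
  · rw [reflMap_apply, reflMap_apply, inner_sub_left, real_inner_smul_left,
      div_mul_cancel₀ _ h]
    rw [show ⟪x, α⟫ - 2 * ⟪x, α⟫ = -⟪x, α⟫ by ring]
    rw [show 2 * -⟪x, α⟫ / ⟪α, α⟫ = -(2 * ⟪x, α⟫ / ⟪α, α⟫) by ring, neg_smul]
    abel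

/-- The reflection determined by a vector `α`, as a linear automorphism of `V`. -/
def sref (α : V) : V ≃ₗ[ℝ] V :=
  { reflMap V α with
    invFun := reflMap V α
    left_inv := reflMap_involutive V α
    right_inv := reflMap_involutive V α }

lemma sref_apply (α x : V) :
    sref V α x = x - (2 * ⟪x, α⟫ / ⟪α, α⟫) • α := rfl

variable {V}

/-- The coroot `α^∨ = 2α/⟪α,α⟫` associated with a root `α`, under the identification of the
coweight space with `V` given by the inner product. -/
def coroot (α : V) : V := (2 / ⟪α, α⟫) • α

/-- The dimension of the `(-1)`-eigenspace of a linear automorphism. -/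
def lamEig (σ : V ≃ₗ[ℝ] V) : ℕ :=
  Module.finrank ℝ (Module.End.eigenspace (σ : V →ₗ[ℝ] V) (-1))

/-- The action `s_α ∘ σ` of a simple reflection on an involution: `s_α σ` if `s_α` and `σ`
commute, and `s_α σ s_α` otherwise. -/
def circAct (α : V) (σ : V ≃ₗ[ℝ] V) : V ≃ₗ[ℝ] V :=
  if sref V α * σ = σ * sref V α then sref V α * σ else sref V α * σ * sref V α

/-- A set of pairwise orthogonal vectors. -/
def OrthSet (S : Finset V) : Prop :=
  (↑S : Set V).Pairwise fun a b => ⟪a, b⟫ = 0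

/-- The product `σ_S` of the (commuting) reflections in the elements of an orthogonal set
`S`. -/
def sigmaOf (S : Finset V) : V ≃ₗ[ℝ] V :=
  (S.toList.map (sref V)).prod

variable (V)

/-- A finite crystallographic reduced root system in the Euclidean space `V`,
together with a fixed choice of simple roots. -/
structure RSD where
  /-- The set of roots. -/
  Φ : Finset V
  /-- The set of simple roots. -/
  Δ : Finset V
  nonzero : (0 : V) ∉ Φ
  span_top : Submodule.span ℝ (Φ : Set V) = ⊤
  reduced : ∀ α ∈ Φ, ∀ c : ℝ, c • α ∈ Φ → c = 1 ∨ c = -1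
  crystal : ∀ α ∈ Φ, ∀ β ∈ Φ, ∃ n : ℤ, (n : ℝ) = 2 * ⟪β, α⟫ / ⟪α, α⟫
  reflClosed : ∀ α ∈ Φ, ∀ β ∈ Φ, sref V α β ∈ Φ
  Δ_sub : Δ ⊆ Φ
  Δ_indep : LinearIndependent ℝ (fun x : (Δ : Set V) => (x : V))
  Δ_base : ∀ α ∈ Φ, (∃ c : V → ℕ, α = ∑ γ ∈ Δ, (c γ : ℝ) • γ) ∨
      (∃ c : V → ℕ, -α = ∑ γ ∈ Δ, (c γ : ℝ) • γ)

namespace RSD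

variable {V}
variable (D : RSD V)

/-- The set of positive roots. -/
def Pos : Set V :=
  {α | α ∈ D.Φ ∧ ∃ c : V → ℕ, α = ∑ γ ∈ D.Δ, (c γ : ℝ) • γ}

/-- The set of negative roots. -/
def Neg : Set V := {α | -α ∈ D.Pos}

/-- The Weyl group, as the subgroup of `GL(V)` generated by the simple reflections. -/
def W : Subgroup (V ≃ₗ[ℝ] V) := Subgroup.closure ((fun γ => sref V γ) '' ↑D.Δ)

/-- The length of `w`: the least number of simple reflections needed to write `w` as a
product of simple reflections. -/
def length (w : V ≃ₗ[ℝ] V) : ℕ :=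
  sInf {n | ∃ l : List V, l.length = n ∧ (∀ γ ∈ l, γ ∈ D.Δ) ∧ w = (l.map (sref V)).prod}

/-- The Bruhat order on the Weyl group: `u ≤ v` iff `v` is obtained from `u` by successively
multiplying by reflections, each time increasing the length. -/
def ble (u v : V ≃ₗ[ℝ] V) : Prop :=
  Relation.ReflTransGen
    (fun x y => (∃ β ∈ D.Φ, y = sref V β * x) ∧ D.length x < D.length y) u v

/-- The strict Bruhat order. -/
def blt (u v : V ≃ₗ[ℝ] V) : Prop := D.ble u v ∧ u ≠ v

/-- The dominance order: `y - x` is a nonnegative integer combination of simple roots. -/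
def dom (x y : V) : Prop := ∃ c : V → ℕ, y - x = ∑ γ ∈ D.Δ, (c γ : ℝ) • γ

/-- The dominance order on coweights: `y - x` is a nonnegative integer combination of simple
coroots. -/
def cdom (x y : V) : Prop := ∃ c : V → ℕ, y - x = ∑ γ ∈ D.Δ, (c γ : ℝ) • coroot γ

/-- The length `L(σ) = (ℓ(σ) + λ(σ))/2` of an involution `σ`, where `λ(σ)` is the dimension
of the `(-1)`-eigenspace of `σ`. -/
def Linv (σ : V ≃ₗ[ℝ] V) : ℚ :=
  ((D.length σ : ℚ) + (lamEig σ : ℚ)) / 2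

end RSD

/-- A finite irreducible crystallographic reduced root system, with a fixed choice of simple
roots and a marked simple root `αP` whose coefficient in the highest root `θ` equals `1`
(the cominuscule case). -/
structure MRSD extends RSD V where
  irred : ¬ ∃ A B : Set V, A.Nonempty ∧ B.Nonempty ∧ A ∪ B = ↑Φ ∧
      ∀ α ∈ A, ∀ β ∈ B, ⟪α, β⟫ = 0
  /-- The marked simple root. -/
  αP : V
  αP_mem : αP ∈ Δ
  /-- The highest root. -/
  θ : V
  θ_mem : θ ∈ Φ
  θ_high : ∀ α ∈ Φ, ∃ c : V → ℕ, θ - α = ∑ γ ∈ Δ, (c γ : ℝ) • γ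
  θ_coeff : ∃ c : V → ℕ, (θ = ∑ γ ∈ Δ, (c γ : ℝ) • γ) ∧ c αP = 1

namespace MRSD

variable {V}
variable (M : MRSD V)

/-- The set `Ψ` of positive roots in which the marked simple root `αP` has coefficient `1`. -/
def Psi : Set V :=
  {α | α ∈ M.Φ ∧ ∃ c : V → ℕ, (α = ∑ γ ∈ M.Δ, (c γ : ℝ) • γ) ∧ c M.αP = 1}

/-- The set of positive roots of the subsystem `Φ_P`, i.e. the positive roots in which the
marked simple root `αP` has coefficient `0`. -/
def PosP : Set V :=
  {α | α ∈ M.Φ ∧ ∃ c : V → ℕ, (α = ∑ γ ∈ M.Δ, (c γ : ℝ) • γ) ∧ c M.αP = 0}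

/-- The parabolic subgroup `W_P` generated by the simple reflections in `Δ ∖ {αP}`. -/
def WP : Subgroup (V ≃ₗ[ℝ] V) :=
  Subgroup.closure ((fun γ => sref V γ) '' ↑(M.Δ.erase M.αP))

/-- The inversion set `Φ⁺(v) = {α ∈ Φ⁺ : v(α) ∈ Φ⁻}`. -/
def InvSet (v : V ≃ₗ[ℝ] V) : Set V := {α | α ∈ M.Pos ∧ v α ∈ M.Neg}

/-- `v` belongs to `W^P`: it lies in `W` and has minimal length in its coset `v W_P`. -/
def IsMinRep (v : V ≃ₗ[ℝ] V) : Prop :=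
  v ∈ M.W ∧ ∀ u, u ∈ M.W → v⁻¹ * u ∈ M.WP → M.length v ≤ M.length u

/-- `μ` is the minimal length representative `[w]^P` of the coset `w W_P`. -/
def IsMinRepOf (μ w : V ≃ₗ[ℝ] V) : Prop :=
  (μ ∈ M.W ∧ w⁻¹ * μ ∈ M.WP) ∧
    ∀ u, u ∈ M.W → w⁻¹ * u ∈ M.WP → M.length μ ≤ M.length u

/-- The subset `Φ_S = {α ∈ Φ : σ_S(α) = -α}` determined by an orthogonal set of roots `S`. -/
def PhiSet (S : Finset V) : Set V := {α | α ∈ M.Φ ∧ sigmaOf S α = -α}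

/-- A root is long if its squared length is maximal among the roots. -/
def IsLong (α : V) : Prop := ∀ β ∈ M.Φ, ⟪β, β⟫ ≤ ⟪α, α⟫

/-- Admissible pair: `v ∈ W^P`, `S ⊆ Ψ` a set of pairwise orthogonal roots with
`v(S) ⊆ Φ⁻`. -/
def Admissible (v : V ≃ₗ[ℝ] V) (S : Finset V) : Prop :=
  M.IsMinRep v ∧ (↑S : Set V) ⊆ M.Psi ∧ OrthSet S ∧ ∀ β ∈ S, v β ∈ M.Neg

/-- The length `L(v,S) = (ℓ(σ_{v(S)}) + |S|)/2` of an admissible pair `(v,S)`. -/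
def pairL (v : V ≃ₗ[ℝ] V) (S : Finset V) : ℚ :=
  ((M.length (sigmaOf (S.image fun x => v x)) : ℚ) + (S.card : ℚ)) / 2

end MRSD

section Reflections

variable {V}

lemma sref_mul_self (α : V) : sref V α * sref V α = 1 :=
  LinearEquiv.ext (reflMap_involutive V α)

lemma sref_inv (α : V) : (sref V α)⁻¹ = sref V α :=
  inv_eq_of_mul_eq_one_left (sref_mul_self α)

lemma sref_self {α : V} (hα : α ≠ 0) : sref V α α = -α := by
  have h : (⟪α, α⟫ : ℝ) ≠ 0 := inner_self_ne_zero.mpr hα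
  rw [sref_apply, mul_div_assoc, div_self h, mul_one, two_smul]
  abel

/-- A linear isometry `w` conjugates the reflection in `α` to the reflection in `w α`. -/
lemma mul_sref_of_isometry (w : V ≃ₗ[ℝ] V) (hw : ∀ x y : V, ⟪w x, w y⟫ = ⟪x, y⟫) (α : V) :
    w * sref V α = sref V (w α) * w := by
  ext x
  simp only [LinearEquiv.mul_apply, sref_apply, hw, map_sub, map_smul]

lemma inner_sref_sref (α x y : V) : ⟪sref V α x, sref V α y⟫ = ⟪x, y⟫ := by
  by_cases h : α = 0
  · simp [sref_apply, h]
  have h' : (⟪α, α⟫ : ℝ) ≠ 0 := inner_self_ne_zero.mpr h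
  simp only [sref_apply, inner_sub_left, inner_sub_right, real_inner_smul_left,
    real_inner_smul_right, real_inner_comm y α]
  field_simp
  ring

lemma inner_prod_sref (l : List V) (x y : V) :
    ⟪(l.map (sref V)).prod x, (l.map (sref V)).prod y⟫ = ⟪x, y⟫ := by
  induction l with
  | nil => simp
  | cons γ l ih => simp [LinearEquiv.mul_apply, inner_sref_sref, ih]

lemma det_sref [FiniteDimensional ℝ V] {α : V} (hα : α ≠ 0) :
    LinearMap.det (sref V α : V →ₗ[ℝ] V) = -1 := by
  have h : (⟪α, α⟫ : ℝ) ≠ 0 := inner_self_ne_zero.mpr hα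
  have e : (sref V α : V →ₗ[ℝ] V)
      = LinearMap.transvection ((-2 / ⟪α, α⟫ : ℝ) • innerₛₗ ℝ α) α := by
    ext x
    simp only [LinearEquiv.coe_coe, sref_apply, LinearMap.transvection.apply, LinearMap.smul_apply,
      innerₛₗ_apply_apply, smul_eq_mul, real_inner_comm α x]
    module
  rw [e, LinearMap.transvection.det]
  simp only [LinearMap.smul_apply, innerₛₗ_apply_apply, smul_eq_mul]
  field_simp
  ring

lemma lamEig_conj_sref (α : V) (σ : V ≃ₗ[ℝ] V) :
    lamEig (sref V α * σ * sref V α) = lamEig σ := by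
  have hs' : ∀ x, sref V α (sref V α x) = x := reflMap_involutive V α
  have h : (Module.End.eigenspace (σ : V →ₗ[ℝ] V) (-1)).map (sref V α : V →ₗ[ℝ] V)
      = Module.End.eigenspace ((sref V α * σ * sref V α : V ≃ₗ[ℝ] V) : V →ₗ[ℝ] V) (-1) := by
    ext x
    simp only [Submodule.mem_map, Module.End.mem_eigenspace_iff, LinearEquiv.coe_coe,
      LinearEquiv.mul_apply]
    constructor
    · rintro ⟨y, hy, rfl⟩
      rw [hs', hy, map_smul]
    · intro hx
      refine ⟨sref V α x, ?_, hs' x⟩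
      rw [← hs' (σ _), hx, map_smul]
  rw [lamEig, lamEig, ← h]
  exact LinearEquiv.finrank_map_eq (sref V α) _

/-- Multiplying by a reflection in a fixed vector raises the multiplicity of `-1` by one. -/
lemma lamEig_sref_mul [FiniteDimensional ℝ V] {α : V} (hα : α ≠ 0) {σ : V ≃ₗ[ℝ] V}
    (hc : sref V α * σ = σ * sref V α) (hσ : σ α = α) :
    lamEig (sref V α * σ) = lamEig σ + 1 := by
  have h2 : ∀ x, sref V α (σ x) = σ (sref V α x) := fun x => DFunLike.congr_fun hc x
  have fixes : ∀ v, σ v = -v → sref V α v = v := by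
    intro v hv
    have := h2 v
    rw [hv, map_neg, sref_apply, map_sub, map_smul, hv, hσ] at this
    set k := 2 * ⟪v, α⟫ / ⟪α, α⟫ with hk
    have h0 : (2 * k) • α = 0 := by
      rw [two_mul, add_smul]
      have h3 := sub_eq_zero.mpr this
      rw [← h3]; abel
    have : k = 0 := by simpa [hα] using h0
    rw [sref_apply, ← hk, this]; simp
  have hs' : ∀ x, sref V α (sref V α x) = x := reflMap_involutive V α
  have e : Module.End.eigenspace ((sref V α * σ : V ≃ₗ[ℝ] V) : V →ₗ[ℝ] V) (-1)
      = Module.End.eigenspace (σ : V →ₗ[ℝ] V) (-1) ⊔ Submodule.span ℝ {α} := by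
    apply le_antisymm
    · intro v hv
      simp only [Module.End.mem_eigenspace_iff, LinearEquiv.coe_coe, LinearEquiv.mul_apply,
        neg_smul, one_smul] at hv
      have hv' : σ v = -sref V α v := by rw [← map_neg, ← hv, hs']
      rw [sref_apply] at hv'
      set k := 2 * ⟪v, α⟫ / ⟪α, α⟫
      refine Submodule.mem_sup.mpr ⟨v - (k / 2) • α, ?_, (k / 2) • α,
        Submodule.smul_mem _ _ (Submodule.mem_span_singleton_self α), by abel⟩
      simp only [Module.End.mem_eigenspace_iff, LinearEquiv.coe_coe, map_sub, map_smul, hv', hσ]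
      module
    · refine sup_le ?_ ?_
      · intro v hv
        simp only [Module.End.mem_eigenspace_iff, LinearEquiv.coe_coe, LinearEquiv.mul_apply,
          neg_smul, one_smul] at hv ⊢
        rw [hv, map_neg, fixes v hv]
      · rw [Submodule.span_singleton_le_iff_mem]
        simp [hσ, sref_self hα]
  have hd : Module.End.eigenspace (σ : V →ₗ[ℝ] V) (-1) ⊓ Submodule.span ℝ {α} = ⊥ := by
    rw [eq_bot_iff]
    rintro v ⟨hv, hv'⟩
    obtain ⟨c, rfl⟩ := Submodule.mem_span_singleton.mp hv'
    have hv : σ (c • α) = (-1 : ℝ) • c • α := Module.End.mem_eigenspace_iff.mp hv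
    rw [map_smul, hσ, neg_one_smul] at hv
    have := Module.isTorsionFree_int_iff_isAddTorsionFree.mp (.trans_faithfulSMul ℤ ℝ V)
    exact (Submodule.mem_bot ℝ).mpr (self_eq_neg.mp hv)
  have := Submodule.finrank_sup_add_finrank_inf_eq
    (Module.End.eigenspace (σ : V →ₗ[ℝ] V) (-1)) (Submodule.span ℝ {α})
  rw [hd, finrank_bot, finrank_span_singleton hα, add_zero, ← e] at this
  exact this

/-- An involution commuting with a reflection preserves the reflected line. -/
lemma apply_eq_or_neg_of_commute {α : V} (hα : α ≠ 0) {σ : V ≃ₗ[ℝ] V} (hσ : σ * σ = 1)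
    (hc : sref V α * σ = σ * sref V α) : σ α = α ∨ σ α = -α := by
  have h := DFunLike.congr_fun hc α
  rw [LinearEquiv.mul_apply, LinearEquiv.mul_apply, sref_self hα, map_neg, sref_apply] at h
  set k := 2 * ⟪σ α, α⟫ / ⟪α, α⟫
  have h1 : σ α = (k / 2) • α := by
    linear_combination (norm := module) (1 / 2 : ℝ) • h
  have h2 : σ (σ α) = α := DFunLike.congr_fun hσ α
  have h3 : ((k / 2) * (k / 2) - 1) • α = 0 := by
    rw [sub_smul, mul_smul, ← h1, ← map_smul, ← h1, h2, one_smul, sub_self]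
  have h4 : (k / 2) * (k / 2) = 1 := by
    have := (smul_eq_zero.mp h3).resolve_right hα
    linarith
  rcases mul_self_eq_one_iff.mp h4 with h5 | h5 <;> simp [h1, h5]

end Reflections

namespace RSD

variable {V} (D : RSD V)

lemma ne_zero_of_mem_Δ {α : V} (hα : α ∈ D.Δ) : α ≠ 0 :=
  fun h => D.nonzero (h ▸ D.Δ_sub hα)

lemma mem_Pos_of_mem_Δ {α : V} (hα : α ∈ D.Δ) : α ∈ D.Pos :=
  ⟨D.Δ_sub hα, fun γ => if γ = α then 1 else 0, by simp [ite_smul, hα]⟩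

lemma neg_mem {α : V} (hα : α ∈ D.Φ) : -α ∈ D.Φ := by
  have := D.reflClosed α hα α hα
  rwa [sref_self (fun h => D.nonzero (h ▸ hα))] at this

lemma mem_Pos_or_mem_Neg {α : V} (hα : α ∈ D.Φ) : α ∈ D.Pos ∨ α ∈ D.Neg :=
  (D.Δ_base α hα).imp (fun h => ⟨hα, h⟩) fun h => ⟨D.neg_mem hα, h⟩

lemma coeff_eq_zero {f : V → ℝ} (h : ∑ γ ∈ D.Δ, f γ • γ = 0) {γ : V} (hγ : γ ∈ D.Δ) :
    f γ = 0 :=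
  (linearIndepOn_finset_iff (v := id)).mp D.Δ_indep f h γ hγ

lemma not_mem_Neg_of_mem_Pos {α : V} (hα : α ∈ D.Pos) : α ∉ D.Neg := by
  rintro ⟨-, d, hd⟩
  obtain ⟨hΦ, c, hc⟩ := hα
  have h : ∑ γ ∈ D.Δ, ((c γ : ℝ) + d γ) • γ = 0 := by
    simp only [add_smul, Finset.sum_add_distrib]
    rw [← hc, ← hd, add_neg_cancel]
  refine D.nonzero ?_
  have h0 : α = 0 := by
    rw [hc]
    refine Finset.sum_eq_zero fun γ hγ => ?_
    have := D.coeff_eq_zero h hγ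
    have hc0 : (c γ : ℝ) = 0 := by
      have h1 : (0 : ℝ) ≤ c γ := by positivity
      have h2 : (0 : ℝ) ≤ d γ := by positivity
      linarith
    rw [hc0, zero_smul]
  exact h0 ▸ hΦ

/-- The only positive root made negative by a simple reflection is the simple root itself. -/
lemma eq_of_sref_mem_Neg {γ β : V} (hγ : γ ∈ D.Δ) (hβ : β ∈ D.Pos)
    (h : sref V γ β ∈ D.Neg) : β = γ := by
  obtain ⟨-, d, hd⟩ := h
  obtain ⟨hΦ, c, hc⟩ := hβ
  rw [sref_apply] at hd
  set k := 2 * ⟪β, γ⟫ / ⟪γ, γ⟫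
  have hs : ∑ δ ∈ D.Δ, ((c δ : ℝ) + d δ - if δ = γ then k else 0) • δ = 0 := by
    simp only [sub_smul, add_smul, Finset.sum_sub_distrib, Finset.sum_add_distrib, ite_smul,
      zero_smul, Finset.sum_ite_eq', hγ, if_true]
    rw [← hc, ← hd]
    abel
  have hz : ∀ δ ∈ D.Δ, δ ≠ γ → (c δ : ℝ) = 0 := by
    intro δ hδ hne
    have := D.coeff_eq_zero hs hδ
    rw [if_neg hne] at this
    have h1 : (0 : ℝ) ≤ c δ := by positivity
    have h2 : (0 : ℝ) ≤ d δ := by positivity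
    linarith
  have hβ : β = (c γ : ℝ) • γ := by
    rw [hc, Finset.sum_eq_single γ]
    · intro δ hδ hne
      rw [hz δ hδ hne, zero_smul]
    · exact fun h => absurd hγ h
  rcases D.reduced γ (D.Δ_sub hγ) (c γ) (hβ ▸ hΦ) with h1 | h1
  · rw [hβ, h1, one_smul]
  · have : (0 : ℝ) ≤ c γ := by positivity
    linarith

lemma prod_sref_mem {l : List V} (hl : ∀ γ ∈ l, γ ∈ D.Δ) {α : V} (hα : α ∈ D.Φ) :
    (l.map (sref V)).prod α ∈ D.Φ := by
  induction l with
  | nil => simpa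
  | cons γ l ih =>
    simp only [List.map_cons, List.prod_cons, LinearEquiv.mul_apply]
    exact D.reflClosed γ (D.Δ_sub (hl γ (by simp))) _ (ih fun δ hδ => hl δ (by simp [hδ]))

/-- The exchange condition: if a product of simple reflections makes `α` negative, then
multiplying it by `s_α` amounts to deleting one of the factors. -/
lemma exists_exchange {α : V} (hα : α ∈ D.Δ) (l : List V) (hl : ∀ γ ∈ l, γ ∈ D.Δ)
    (h : (l.map (sref V)).prod α ∈ D.Neg) :
    ∃ l' : List V, l'.length + 1 = l.length ∧ (∀ γ ∈ l', γ ∈ D.Δ) ∧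
      (l'.map (sref V)).prod = (l.map (sref V)).prod * sref V α := by
  induction l with
  | nil => exact absurd h (D.not_mem_Neg_of_mem_Pos (D.mem_Pos_of_mem_Δ hα))
  | cons γ t ih =>
    have hγ := hl γ (by simp)
    have ht : ∀ δ ∈ t, δ ∈ D.Δ := fun δ hδ => hl δ (by simp [hδ])
    rcases D.mem_Pos_or_mem_Neg (D.prod_sref_mem ht (D.Δ_sub hα)) with hp | hn
    · refine ⟨t, by simp, ht, ?_⟩
      simp only [List.map_cons, List.prod_cons, LinearEquiv.mul_apply] at h ⊢
      have e := D.eq_of_sref_mem_Neg hγ hp h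
      rw [mul_assoc, mul_sref_of_isometry _ (inner_prod_sref t), e, ← mul_assoc, sref_mul_self,
        one_mul]
    · obtain ⟨t', h1, h2, h3⟩ := ih ht hn
      refine ⟨γ :: t', by simp [h1], ?_, by simp [h3, mul_assoc]⟩
      intro δ hδ
      rcases List.mem_cons.mp hδ with rfl | hδ
      exacts [hγ, h2 δ hδ]

lemma length_prod_le {l : List V} (hl : ∀ γ ∈ l, γ ∈ D.Δ) :
    D.length (l.map (sref V)).prod ≤ l.length :=
  Nat.sInf_le ⟨l, rfl, hl, rfl⟩

lemma sref_mem_W {α : V} (hα : α ∈ D.Δ) : sref V α ∈ D.W :=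
  Subgroup.subset_closure ⟨α, hα, rfl⟩

lemma exists_reduced_word {w : V ≃ₗ[ℝ] V} (hw : w ∈ D.W) :
    ∃ l : List V, l.length = D.length w ∧ (∀ γ ∈ l, γ ∈ D.Δ) ∧ w = (l.map (sref V)).prod := by
  refine Nat.sInf_mem (s := {n | ∃ l : List V, l.length = n ∧ (∀ γ ∈ l, γ ∈ D.Δ) ∧
    w = (l.map (sref V)).prod}) ?_
  have step : ∀ x ∈ D.Δ, ∀ y : V ≃ₗ[ℝ] V,
      (∃ l : List V, (∀ γ ∈ l, γ ∈ D.Δ) ∧ y = (l.map (sref V)).prod) →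
      ∃ l : List V, (∀ γ ∈ l, γ ∈ D.Δ) ∧ sref V x * y = (l.map (sref V)).prod := by
    rintro x hx y ⟨l, hl, rfl⟩
    refine ⟨x :: l, fun δ hδ => ?_, by simp⟩
    rcases List.mem_cons.mp hδ with rfl | hδ
    exacts [hx, hl δ hδ]
  have : ∃ l : List V, (∀ γ ∈ l, γ ∈ D.Δ) ∧ w = (l.map (sref V)).prod := by
    induction hw using Subgroup.closure_induction_left with
    | one => exact ⟨[], by simp, by simp⟩
    | mul_left x hx y _ ih =>
      obtain ⟨γ, hγ, rfl⟩ := hx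
      exact step γ hγ y ih
    | inv_mul_cancel x hx y _ ih =>
      obtain ⟨γ, hγ, rfl⟩ := hx
      simp only [sref_inv]
      exact step γ hγ y ih
  obtain ⟨l, hl, h⟩ := this
  exact ⟨_, l, rfl, hl, h⟩

lemma length_sref_mul_le {α : V} (hα : α ∈ D.Δ) {w : V ≃ₗ[ℝ] V} (hw : w ∈ D.W) :
    D.length (sref V α * w) ≤ D.length w + 1 := by
  obtain ⟨l, h1, h2, h3⟩ := D.exists_reduced_word hw
  have := D.length_prod_le (l := α :: l) fun δ hδ => by
    rcases List.mem_cons.mp hδ with rfl | hδ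
    exacts [hα, h2 δ hδ]
  simpa [← h3, h1] using this

lemma length_mul_sref_le {α : V} (hα : α ∈ D.Δ) {w : V ≃ₗ[ℝ] V} (hw : w ∈ D.W) :
    D.length (w * sref V α) ≤ D.length w + 1 := by
  obtain ⟨l, h1, h2, h3⟩ := D.exists_reduced_word hw
  have := D.length_prod_le (l := l ++ [α]) fun δ hδ => by
    rcases List.mem_append.mp hδ with hδ | hδ
    exacts [h2 δ hδ, List.mem_singleton.mp hδ ▸ hα]
  simpa [← h3, h1] using this

lemma length_mul_sref_lt {α : V} (hα : α ∈ D.Δ) {w : V ≃ₗ[ℝ] V} (hw : w ∈ D.W)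
    (h : w α ∈ D.Neg) : D.length (w * sref V α) < D.length w := by
  obtain ⟨l, h1, h2, h3⟩ := D.exists_reduced_word hw
  obtain ⟨l', h4, h5, h6⟩ := D.exists_exchange hα l h2 (h3 ▸ h)
  have := D.length_prod_le h5
  rw [h6, ← h3] at this
  omega

lemma det_eq_neg_one_pow_length [FiniteDimensional ℝ V] {w : V ≃ₗ[ℝ] V} (hw : w ∈ D.W) :
    LinearMap.det (w : V →ₗ[ℝ] V) = (-1) ^ D.length w := by
  have key : ∀ l : List V, (∀ γ ∈ l, γ ∈ D.Δ) →
      LinearMap.det (((l.map (sref V)).prod : V ≃ₗ[ℝ] V) : V →ₗ[ℝ] V) = (-1) ^ l.length := by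
    intro l hl
    induction l with
    | nil => exact LinearMap.det_id
    | cons γ t ih =>
      rw [List.length_cons, pow_succ', ← ih fun δ hδ => hl δ (by simp [hδ]),
        ← det_sref (D.ne_zero_of_mem_Δ (hl γ (by simp))), ← map_mul]
      rfl
  obtain ⟨l, h1, h2, h3⟩ := D.exists_reduced_word hw
  rw [← h1, ← key l h2, ← h3]

lemma even_length_iff [FiniteDimensional ℝ V] {w : V ≃ₗ[ℝ] V} (hw : w ∈ D.W) :
    Even (D.length w) ↔ LinearMap.det (w : V →ₗ[ℝ] V) = 1 := by
  rw [D.det_eq_neg_one_pow_length hw, neg_one_pow_eq_one_iff_even (by norm_num)]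

lemma even_length_conj_sref_iff [FiniteDimensional ℝ V] {α : V} (hα : α ∈ D.Δ)
    {w : V ≃ₗ[ℝ] V} (hw : w ∈ D.W) :
    Even (D.length (sref V α * w * sref V α)) ↔ Even (D.length w) := by
  have hs := D.sref_mem_W hα
  have h : LinearMap.det ((sref V α * w * sref V α : V ≃ₗ[ℝ] V) : V →ₗ[ℝ] V)
      = LinearMap.det (sref V α : V →ₗ[ℝ] V) * LinearMap.det (w : V →ₗ[ℝ] V)
        * LinearMap.det (sref V α : V →ₗ[ℝ] V) := by
    rw [← map_mul, ← map_mul]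
    rfl
  rw [D.even_length_iff (mul_mem (mul_mem hs hw) hs), D.even_length_iff hw, h,
    det_sref (D.ne_zero_of_mem_Δ hα)]
  simp

lemma length_lt_of_blt {u v : V ≃ₗ[ℝ] V} (h : D.blt u v) : D.length u < D.length v := by
  have key : u = v ∨ D.length u < D.length v := by
    obtain ⟨h, -⟩ := h
    induction h with
    | refl => exact Or.inl rfl
    | tail _ hs ih =>
      rcases ih with rfl | ih
      exacts [Or.inr hs.2, Or.inr (ih.trans hs.2)]
  exact key.resolve_left h.2

lemma length_add_one_of_commute [FiniteDimensional ℝ V] {α : V} (hα : α ∈ D.Δ)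
    {σ : V ≃ₗ[ℝ] V} (hσW : σ ∈ D.W) (hc : sref V α * σ = σ * sref V α) (hσ : σ α = α) :
    D.length (sref V α * σ) = D.length σ + 1 := by
  have hτ : sref V α * σ ∈ D.W := mul_mem (D.sref_mem_W hα) hσW
  have hn : (sref V α * σ) α ∈ D.Neg := by
    rw [LinearEquiv.mul_apply, hσ, sref_self (D.ne_zero_of_mem_Δ hα)]
    simpa [Neg] using D.mem_Pos_of_mem_Δ hα
  have h1 := D.length_mul_sref_lt hα hτ hn
  rw [hc, mul_assoc, sref_mul_self, mul_one, ← hc] at h1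
  have h2 := D.length_sref_mul_le hα hσW
  omega

lemma Linv_add_one_of_commute [FiniteDimensional ℝ V] {α : V} (hα : α ∈ D.Δ)
    {σ : V ≃ₗ[ℝ] V} (hσW : σ ∈ D.W) (hc : sref V α * σ = σ * sref V α) (hσ : σ α = α) :
    D.Linv (sref V α * σ) = D.Linv σ + 1 := by
  rw [Linv, Linv, D.length_add_one_of_commute hα hσW hc hσ,
    lamEig_sref_mul (D.ne_zero_of_mem_Δ hα) hc hσ]
  push_cast
  ring

end RSD

/-- Let `α ∈ Δ` and `σ ∈ 𝓘`.  Then `L(s_α ∘ σ) = L(σ) + 1` if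
`s_α ∘ σ > σ`, and `L(s_α ∘ σ) = L(σ) - 1` if `s_α ∘ σ < σ`. -/
theorem statement10 {V : Type} [NormedAddCommGroup V] [InnerProductSpace ℝ V]
    [FiniteDimensional ℝ V]
    (D : RSD V) (α : V) (hα : α ∈ D.Δ)
    (σ : V ≃ₗ[ℝ] V) (hσW : σ ∈ D.W) (hσ : σ * σ = 1) :
    (D.blt σ (circAct α σ) → D.Linv (circAct α σ) = D.Linv σ + 1) ∧
    (D.blt (circAct α σ) σ → D.Linv (circAct α σ) = D.Linv σ - 1) := by
  have hα0 := D.ne_zero_of_mem_Δ hα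
  have hs := D.sref_mem_W hα
  have hτW : sref V α * σ ∈ D.W := mul_mem hs hσW
  by_cases hc : sref V α * σ = σ * sref V α
  · rw [circAct, if_pos hc]
    have hττ : sref V α * (sref V α * σ) = σ := by rw [← mul_assoc, sref_mul_self, one_mul]
    rcases apply_eq_or_neg_of_commute hα0 hσ hc with h | h
    · have hl := D.length_add_one_of_commute hα hσW hc h
      refine ⟨fun _ => D.Linv_add_one_of_commute hα hσW hc h, fun hb => ?_⟩
      have := D.length_lt_of_blt hb
      omega
    · have hτc : sref V α * (sref V α * σ) = sref V α * σ * sref V α := by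
        rw [mul_assoc, ← hc]
      have hτα : (sref V α * σ) α = α := by
        rw [LinearEquiv.mul_apply, h, map_neg, sref_self hα0, neg_neg]
      have hl := D.length_add_one_of_commute hα hτW hτc hτα
      have hL := D.Linv_add_one_of_commute hα hτW hτc hτα
      rw [hττ] at hl hL
      refine ⟨fun hb => ?_, fun _ => by linarith⟩
      have := D.length_lt_of_blt hb
      omega
  · rw [circAct, if_neg hc, RSD.Linv, RSD.Linv, lamEig_conj_sref]
    have hp := D.even_length_conj_sref_iff hα hσW
    have h1 := D.length_sref_mul_le hα hσW
    have h2 := D.length_mul_sref_le hα hτW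
    have h3 := D.length_sref_mul_le hα (mul_mem hτW hs)
    rw [← mul_assoc, ← mul_assoc, sref_mul_self, one_mul] at h3
    have h4 := D.length_mul_sref_le hα (mul_mem hσW hs)
    rw [mul_assoc, sref_mul_self, mul_one] at h4
    simp only [Nat.even_iff] at hp
    constructor
    · intro hb
      have := D.length_lt_of_blt hb
      have e : D.length (sref V α * σ * sref V α) = D.length σ + 2 := by omega
      rw [e]
      push_cast
      ring
    · intro hb
      have := D.length_lt_of_blt hb
      have e : D.length σ = D.length (sref V α * σ * sref V α) + 2 := by omega
      rw [e]
      push_cast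
      ring
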